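/- arXiv:2303.15045 — 3 statements merged into one kernel-verified Lean document; each statement's English description precedes it below -/
import Mathlib

section
/- For every infinite type α there exists a binary relation r : α → α → Prop such that the graph (α, r) is rigid: every endomorphism of (α, r) — i.e., every map f : α → α such that r x y implies r (f x) (f y) for all x, y — is the identity map. -/
namespace RigidRel

/-- Cofinal `ω`-sequences below `β`. -/
def IsLadder {W : Type*} [LinearOrder W] (β : W) (s : ℕ → W) : Prop :=
  (∀ n, s n < β) ∧ ∀ γ, γ < β → ∃ n, γ ≤ s n

/-- `x` is the `n`-th entry of the chosen ladder of `β` (if there is one). -/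
def Lad {W : Type*} [LinearOrder W] (β : W) (n : ℕ) (x : W) : Prop :=
  ∃ h : ∃ s, IsLadder β s, h.choose n = x

/-- The vertices: a gadget with three elements, and `W × ℕ`. -/
inductive Vert (W : Type*) : Type _
  | a : Vert W
  | b : Vert W
  | c : Vert W
  | node : W → ℕ → Vert W

/-- The edges. -/
inductive Edge {W : Type*} [LinearOrder W] : Vert W → Vert W → Prop
  | ab : Edge .a .b
  | bc : Edge .b .c
  | ca : Edge .c .a
  | ac : Edge .a .c
  | cn (x n) : Edge .c (.node x n)
  | az (x) : Edge .a (.node x 0)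
  | bs (x n) : Edge .b (.node x (n + 1))
  | succ (x n) : Edge (.node x n) (.node x (n + 1))
  | lt (x y) : x < y → Edge (.node x 0) (.node y 0)
  | lad (x y n) : Lad y n x → Edge (.node x (n + 1)) (.node y 0)

theorem Lad.unique {W : Type*} [LinearOrder W] {β : W} {n : ℕ} {x y : W}
    (hx : Lad β n x) (hy : Lad β n y) : x = y := by
  obtain ⟨h, rfl⟩ := hx
  obtain ⟨h', rfl⟩ := hy
  rfl

theorem Lad.lt {W : Type*} [LinearOrder W] {β : W} {n : ℕ} {x : W}
    (hx : Lad β n x) : x < β := by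
  obtain ⟨h, rfl⟩ := hx
  exact h.choose_spec.1 n

theorem Edge.of_zero {W : Type*} [LinearOrder W] {x y : W}
    (h : Edge (.node x 0) (.node y 0)) : x < y := by
  cases h with
  | lt _ _ h => exact h

theorem Edge.of_succ {W : Type*} [LinearOrder W] {x y : W} {n : ℕ}
    (h : Edge (.node x (n + 1)) (.node y 0)) : Lad y n x := by
  cases h with
  | lad _ _ _ h => exact h

/-- The order-theoretic core. -/
theorem core {W : Type*} [LinearOrder W] [WellFoundedLT W] [OrderTop W] (g : W → W)
    (hg : StrictMono g) (hl : ∀ β n x, Lad β n x → Lad (g β) n (g x)) (x : W) : g x = x := by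
  by_contra hne
  have hx0 : x < g x := lt_of_le_of_ne (hg.le_apply) (Ne.symm hne)
  let s : ℕ → W := fun k => g^[k] x
  have hs1 : ∀ k, s (k + 1) = g (s k) := fun k => Function.iterate_succ_apply' g k x
  have hs : ∀ k, s k < s (k + 1) := by
    intro k
    induction k with
    | zero => exact hx0
    | succ k ih => rw [hs1 (k + 1), hs1 k]; rw [hs1 k] at ih; exact hg ih
  obtain ⟨β, hβ, hmin⟩ := WellFounded.has_min (wellFounded_lt (α := W)) {u | ∀ k, s k ≤ u}
    ⟨⊤, fun k => le_top⟩
  have hsβ : ∀ k, s k < β := fun k => (hs k).trans_le (hβ (k + 1))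
  have hcof : ∀ γ, γ < β → ∃ k, γ < s k := by
    intro γ hγ
    by_contra! hcon
    exact hmin γ hcon hγ
  have hex : ∃ t, IsLadder β t :=
    ⟨s, hsβ, fun γ hγ => (hcof γ hγ).imp fun _ h => h.le⟩
  have hgl : ∀ n, Lad (g β) n (g (hex.choose n)) := fun n => hl β n _ ⟨hex, rfl⟩
  obtain ⟨hlt, hc⟩ := hex.choose_spec
  have hgb : ∀ n, g (hex.choose n) < β := by
    intro n
    obtain ⟨k, hk⟩ := hcof _ (hlt n)
    have := hg hk
    rw [← hs1] at this
    exact this.trans (hsβ _)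
  rcases (hg.le_apply : β ≤ g β).lt_or_eq with h | h
  · obtain ⟨hex', -⟩ := hgl 0
    obtain ⟨-, hc'⟩ := hex'.choose_spec
    obtain ⟨n, hn⟩ := hc' β h
    have := (hgl n).unique ⟨hex', rfl⟩
    rw [← this] at hn
    exact absurd (hgb n) hn.not_gt
  · obtain ⟨n, hn⟩ := hc x (hsβ 0)
    have hfix : g (hex.choose n) = hex.choose n := by
      have h1 := hgl n
      rw [← h] at h1
      exact h1.unique ⟨hex, rfl⟩
    have hall : ∀ k, s k ≤ hex.choose n := by
      intro k
      induction k with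
      | zero => exact hn
      | succ k ih =>
        rw [hs1, ← hfix]
        exact hg.monotone ih
    exact hmin _ hall (hlt n)

theorem rigid {W : Type*} [LinearOrder W] [WellFoundedLT W] [OrderTop W]
    (f : Vert W → Vert W) (hf : ∀ x y, Edge x y → Edge (f x) (f y)) : f = id := by
  have hac := hf _ _ Edge.ac
  have hca := hf _ _ Edge.ca
  have hab := hf _ _ Edge.ab
  have hbc := hf _ _ Edge.bc
  have habc : f .a = .a ∧ f .b = .b ∧ f .c = .c := by
    generalize f .a = u at *
    generalize f .b = v at *
    generalize f .c = w at *
    cases hac with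
    | ab => cases hca
    | bc => cases hca
    | ca => cases hab <;> cases hbc
    | ac => cases hab <;> cases hbc; simp
    | cn => cases hca
    | az => cases hca
    | bs => cases hca
    | succ =>
      cases hca with
      | lad _ _ _ h => exact absurd h.lt (lt_irrefl _)
    | lt x y h =>
      cases hca with
      | lt _ _ h' => exact absurd h h'.not_gt
    | lad _ _ _ h =>
      cases hca
      exact absurd h.lt (lt_irrefl _)
  obtain ⟨ha, hb, hc⟩ := habc
  have h0 : ∀ x, ∃ y, f (.node x 0) = .node y 0 := by
    intro x
    have h1 := hf _ _ (Edge.az x)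
    have h2 := hf _ _ (Edge.cn x 0)
    rw [ha] at h1
    rw [hc] at h2
    generalize f (.node x 0) = u at *
    cases h1 with
    | ab => cases h2
    | ac => cases h2
    | az y => exact ⟨y, rfl⟩
  choose g hg0 using h0
  have hgn : ∀ x n, f (.node x n) = .node (g x) n := by
    intro x n
    induction n with
    | zero => exact hg0 x
    | succ n ih =>
      have h1 := hf _ _ (Edge.bs x n)
      have h2 := hf _ _ (Edge.cn x (n + 1))
      have h3 := hf _ _ (Edge.succ x n)
      rw [hb] at h1
      rw [hc] at h2
      rw [ih] at h3
      generalize f (.node x (n + 1)) = u at *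
      cases h1 with
      | bc => cases h2
      | bs y m => cases h3; rfl
  have hmono : StrictMono g := by
    intro x y hxy
    have h := hf _ _ (Edge.lt x y hxy)
    rw [hg0, hg0] at h
    exact h.of_zero
  have hlad : ∀ β n x, Lad β n x → Lad (g β) n (g x) := by
    intro β n x h
    have h := hf _ _ (Edge.lad x β n h)
    rw [hgn, hgn] at h
    exact h.of_succ
  funext v
  cases v with
  | a => exact ha
  | b => exact hb
  | c => exact hc
  | node x n => rw [hgn, core g hmono hlad x]; rfl

/-- The vertex set as a sum. -/
def vertEquiv (W : Type*) : Vert W ≃ Fin 3 ⊕ W × ℕ where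
  toFun
    | .a => .inl 0
    | .b => .inl 1
    | .c => .inl 2
    | .node x n => .inr (x, n)
  invFun
    | .inl 0 => .a
    | .inl 1 => .b
    | .inl 2 => .c
    | .inr (x, n) => .node x n
  left_inv v := by cases v <;> rfl
  right_inv v := by
    rcases v with i | ⟨x, n⟩
    · fin_cases i <;> rfl
    · rfl

theorem card_vert (α : Type*) [Infinite α] : Nonempty (α ≃ Vert (WithTop α)) := by
  have h : Cardinal.aleph0 ≤ Cardinal.mk α := Cardinal.aleph0_le_mk α
  have h1 : Cardinal.mk (WithTop α) = Cardinal.mk α := by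
    have : Cardinal.mk (Option α) = Cardinal.mk α := by
      rw [Cardinal.mk_option, Cardinal.add_one_eq h]
    exact this
  rw [← Cardinal.eq, Cardinal.mk_congr (vertEquiv (WithTop α))]
  simp [h1, Cardinal.mul_aleph0_eq h]
  rw [Cardinal.add_eq_right h]
  exact (Cardinal.ofNat_lt_aleph0).le.trans h

end RigidRel

/-- **Vopěnka–Pultr–Hedrlín theorem**: on every infinite type `α` there is a binary
relation `r` making the graph `(α, r)` rigid: every endomorphism of `(α, r)` is the
identity map. -/
theorem exists_rigid_binary_relation (α : Type*) [Infinite α] :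
    ∃ r : α → α → Prop, ∀ f : α → α, (∀ x y, r x y → r (f x) (f y)) → f = id := by
  obtain ⟨_, _⟩ := exists_wellFoundedLT α
  obtain ⟨e⟩ := RigidRel.card_vert α
  refine ⟨fun x y => RigidRel.Edge (e x) (e y), fun f hf => ?_⟩
  have h := RigidRel.rigid (fun v => e (f (e.symm v))) (fun x y hxy => hf _ _ (by simpa using hxy))
  funext x
  have := congrFun h (e x)
  simpa using this
end

section
/- Let α, β be types and F : α → β a function. Let L₀ be the first-order language with exactly one unary relation symbol U (and no other symbols), and let L = L₀[[α]] be L₀ extended by a constant symbol c_a for each a : α. For b : β, let N_b be the L-structure with universe α interpreting U as the predicate {a : α | F a = b} and each constant c_a as a. Then for all b, c in the range of F with b ≠ c, there is no L-embedding from N_b into N_c. -/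
open FirstOrder

/-- The first-order language with exactly one unary relation symbol `U` and no
other symbols. -/
def unaryLang : FirstOrder.Language where
  Functions _ := Empty
  Relations n :=
    match n with
    | 1 => Unit
    | _ => Empty

/-- The `unaryLang`-structure on `α` interpreting the unary relation symbol `U`
as the predicate `X`. -/
def unaryStructure {α : Type*} (X : Set α) : unaryLang.Structure α where
  funMap f _ := nomatch f
  RelMap {n} r v :=
    match n, r, v with
    | 1, _, v => v 0 ∈ X
    | 0, r, _ => nomatch r
    | (_ + 2), r, _ => nomatch r

/-- The `unaryLang[[α]]`-structure `N_b` on universe `α` (for `F : α → β` and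
`b : β`): the unary relation `U` is interpreted as the predicate `{a | F a = b}`,
and each constant symbol `c_a` (for `a : α`) is interpreted as `a` itself. -/
def NStr {α β : Type*} (F : α → β) (b : β) : (unaryLang[[α]]).Structure α :=
  @FirstOrder.Language.sumStructure unaryLang (FirstOrder.Language.constantsOn α) α
    (unaryStructure {a : α | F a = b}) (FirstOrder.Language.constantsOn.structure id)

/-- Core of the derivation of Replacement from EST + VP: for distinct values
`b ≠ c` in the range of `F`, there is no embedding from the structure `N_b` into
the structure `N_c` (for the language with one unary relation symbol and a
constant for each element of `α`). -/
theorem no_embedding_NStr {α β : Type*} (F : α → β) (b c : β)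
    (hb : b ∈ Set.range F) (hc : c ∈ Set.range F) (hbc : b ≠ c) :
    ¬ Nonempty (@FirstOrder.Language.Embedding (unaryLang[[α]]) α α
      (NStr F b) (NStr F c)) := by
  rintro ⟨f⟩
  obtain ⟨a, ha⟩ := hb
  have hfa := @FirstOrder.Language.Embedding.map_fun' (unaryLang[[α]]) α α
    (NStr F b) (NStr F c) f 0 (Sum.inr a) Fin.elim0
  have hr := @FirstOrder.Language.Embedding.map_rel' (unaryLang[[α]]) α α
    (NStr F b) (NStr F c) f 1 (Sum.inl ()) (fun _ => a)
  generalize (@FirstOrder.Language.Embedding.toEmbedding (unaryLang[[α]]) α α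
    (NStr F b) (NStr F c) f) = g at hfa hr
  change g a = a at hfa
  change F (g a) = c ↔ F a = b at hr
  rw [hfa] at hr
  exact hbc (ha.symm.trans (hr.2 ha))
end

section
/- Let X be a class of ZFC sets (X : Class, i.e., a predicate on ZFSet) and suppose X is a proper class, i.e., there is no ZFSet x such that X equals the class of members of x. Then there exists a ZFSet s such that s.toSet is infinite and every element of s belongs to X. -/
/-- **Set-existence content of Proposition 4.4**: a proper class `X` of ZFC sets
(one that is not the class of members of any set) contains an infinite set:
there is a ZFC set `s` whose underlying set of elements is infinite and all of
whose elements belong to `X`. -/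
theorem proper_class_has_infinite_subset (X : Class)
    (hX : ¬ ∃ x : ZFSet, X = ↑x) :
    ∃ s : ZFSet, s.toSet.Infinite ∧ ∀ z : ZFSet, z ∈ s → X z := by
  have hinf : (Set.ofPred X : Set ZFSet).Infinite := by
    intro hfin
    have : Finite (Set.ofPred X : Set ZFSet) := hfin
    apply hX
    refine ⟨ZFSet.range (fun y : (Set.ofPred X : Set ZFSet) => (y : ZFSet)), ?_⟩
    apply Class.ext
    intro z
    rw [Class.coe_apply, ZFSet.mem_range]
    constructor
    · intro h
      exact ⟨⟨z, h⟩, rfl⟩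
    · rintro ⟨⟨y, hy⟩, rfl⟩
      exact hy
  let f := hinf.natEmbedding
  refine ⟨ZFSet.range (fun n : ℕ => (f n : ZFSet)), ?_, ?_⟩
  · have hi : Function.Injective (fun n : ℕ => (f n : ZFSet)) :=
      Subtype.val_injective.comp f.injective
    refine (Set.infinite_range_of_injective hi).mono ?_
    rintro _ ⟨n, rfl⟩
    exact ZFSet.mem_range_self (f := fun n : ℕ => (f n : ZFSet)) n
  · intro z hz
    obtain ⟨n, rfl⟩ := ZFSet.mem_range.1 hz
    exact (f n).2
end
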